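/- arXiv:2605.01003 — 2 statements merged into one kernel-verified Lean document; each statement's English description precedes it below -/
import Mathlib

section
/- Let C : ℕ → ℕ → ℝ be a segment cost and g : ℕ → ℝ a penalty, and for each s let F(s) be the minimum of the Pi-Change objective over all segmentations of {1, …, s}. If a segmentation τ of {1, …, s} with m ≥ 1 change points attains F(s) (i.e. Q_s(τ) = F(s)) and t = τ_m is its last change point, then the truncated segmentation τ' of {1, …, t} attains F(t), i.e. Q_t(τ') = F(t). -/
/-- A segmentation of `{1, …, s}`: a strictly increasing sequence
`0 = τ 0 < τ 1 < ⋯ < τ m < τ (m+1) = s` with `m` change points `τ 1, …, τ m`. -/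
def IsSegmentation (s m : ℕ) (τ : ℕ → ℕ) : Prop :=
  τ 0 = 0 ∧ τ (m + 1) = s ∧ ∀ j ≤ m, τ j < τ (j + 1)

/-- The Pi-Change objective of a segmentation with `m` change points:
`∑_{j=1}^{m+1} C(τ_{j-1}+1, τ_j) + ∑_{j=1}^{m} g(τ_j)`. -/
noncomputable def piObj (C : ℕ → ℕ → ℝ) (g : ℕ → ℝ) (m : ℕ) (τ : ℕ → ℕ) : ℝ :=
  (∑ j ∈ Finset.range (m + 1), C (τ j + 1) (τ (j + 1))) +
    ∑ j ∈ Finset.Icc 1 m, g (τ j)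

/-- The set of Pi-Change objective values over all segmentations of `{1, …, s}`. -/
def objVals (C : ℕ → ℕ → ℝ) (g : ℕ → ℝ) (s : ℕ) : Set ℝ :=
  {x | ∃ m τ, IsSegmentation s m τ ∧ piObj C g m τ = x}

/-- The objective with `n` change points only depends on the values at indices `≤ n + 1`. -/
theorem piObj_congr (C : ℕ → ℕ → ℝ) (g : ℕ → ℝ) {n : ℕ} {σ ρ : ℕ → ℕ}
    (h : ∀ j ≤ n + 1, σ j = ρ j) : piObj C g n σ = piObj C g n ρ := by
  unfold piObj
  congr 1
  · refine Finset.sum_congr rfl fun j hj => ?_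
    have hj' := Finset.mem_range.1 hj
    rw [h j (by omega), h (j + 1) (by omega)]
  · refine Finset.sum_congr rfl fun j hj => ?_
    have hj' := (Finset.mem_Icc.1 hj).2
    rw [h j (by omega)]

/-- Splitting off the last segment and the last change point. -/
theorem piObj_succ (C : ℕ → ℕ → ℝ) (g : ℕ → ℝ) (n : ℕ) (σ : ℕ → ℕ) :
    piObj C g (n + 1) σ =
      piObj C g n σ + (C (σ (n + 1) + 1) (σ (n + 2)) + g (σ (n + 1))) := by
  unfold piObj
  rw [Finset.sum_range_succ _ (n + 1), Finset.sum_Icc_succ_top (by omega)]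
  ring

namespace IsSegmentation

theorem truncate {s n : ℕ} {τ : ℕ → ℕ} (h : IsSegmentation s (n + 1) τ) :
    IsSegmentation (τ (n + 1)) n τ :=
  ⟨h.1, rfl, fun j hj => h.2.2 j (by omega)⟩

/-- Appending a new endpoint turns the old endpoint into the last change point. -/
theorem extend {t s n : ℕ} {σ : ℕ → ℕ} (h : IsSegmentation t n σ) (hts : t < s) :
    IsSegmentation s (n + 1) (Function.update σ (n + 2) s) := by
  obtain ⟨h0, ht, hlt⟩ := h
  refine ⟨by simp [h0], by simp, fun j hj => ?_⟩
  rcases Nat.lt_or_eq_of_le hj with hj | rfl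
  · have h1 : j ≠ n + 2 := by omega
    have h2 : j + 1 ≠ n + 2 := by omega
    rw [Function.update_of_ne h1, Function.update_of_ne h2]
    exact hlt j (by omega)
  · simpa [Function.update_apply, ht] using hts

end IsSegmentation

/-- The objective after appending the endpoint `s` to a segmentation ending at `t`. -/
theorem piObj_extend (C : ℕ → ℕ → ℝ) (g : ℕ → ℝ) {t n : ℕ} {σ : ℕ → ℕ}
    (h : IsSegmentation t n σ) (s : ℕ) :
    piObj C g (n + 1) (Function.update σ (n + 2) s) =
      piObj C g n σ + (C (t + 1) s + g t) := by
  have hcongr : ∀ j ≤ n + 1, Function.update σ (n + 2) s j = σ j := fun j hj =>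
    Function.update_of_ne (by omega) _ _
  rw [piObj_succ, piObj_congr C g hcongr, hcongr (n + 1) le_rfl, h.2.1, Function.update_self]

/-- If a segmentation `τ` of `{1, …, s}` with `m ≥ 1` change points attains
the optimal Pi-Change value `F s`, and `t = τ m` is its last change point, then the truncated
segmentation (namely `τ` viewed with `m − 1` change points, endpoint `t`) attains `F t`. -/
theorem truncation_optimal (C : ℕ → ℕ → ℝ) (g : ℕ → ℝ) (F : ℕ → ℝ)
    (hF : ∀ u, 1 ≤ u → IsLeast (objVals C g u) (F u))
    (s m : ℕ) (hm : 1 ≤ m) (τ : ℕ → ℕ) (hτ : IsSegmentation s m τ)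
    (hopt : piObj C g m τ = F s) :
    piObj C g (m - 1) τ = F (τ m) := by
  obtain ⟨n, rfl⟩ : ∃ n, m = n + 1 := ⟨m - 1, by omega⟩
  rw [Nat.add_sub_cancel]
  have hpos : 1 ≤ τ (n + 1) := Nat.one_le_of_lt (hτ.2.2 n (by omega))
  have hlt : τ (n + 1) < s := hτ.2.1 ▸ hτ.2.2 (n + 1) le_rfl
  refine le_antisymm ?_ ((hF _ hpos).2 ⟨n, τ, hτ.truncate, rfl⟩)
  obtain ⟨k, σ, hσ, hval⟩ := (hF _ hpos).1
  have hle := (hF s (by omega)).2 ⟨k + 1, _, hσ.extend hlt, rfl⟩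
  rw [piObj_extend C g hσ, hval, ← hopt, piObj_succ, hτ.2.1] at hle
  linarith
end

section
/- Let C : ℕ → ℕ → ℝ be a segment cost, g : ℕ → ℝ a penalty, K ∈ ℝ, and let F(·) be the optimal Pi-Change value, which satisfies F(T) = min( C(1, T), min_{1 ≤ u < T} { F(u) + C(u+1, T) + g(u) } ). Suppose that for all t < s < T one has C(t+1, s) + C(s+1, T) + K ≤ C(t+1, T), and that for some 1 ≤ t < s the pruning condition F(t) + C(t+1, s) + g(t) + K ≥ F(s) + g(s) holds. Then for every T > s, removing u = t from the inner minimization does not change its value: F(T) = min( C(1, T), min_{1 ≤ u < T, u ≠ t} { F(u) + C(u+1, T) + g(u) } ). Hence the pruned dynamic program remains exact. -/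
/-- **pruned DP exactness.** Let `F` satisfy the dynamic-programming recursion
`F(T) = min( C(1,T), min_{1 ≤ u < T} { F(u) + C(u+1, T) + g(u) } )` for all `T ≥ 1`. Suppose
`C(t+1, s) + C(s+1, T) + K ≤ C(t+1, T)` for all `t < s < T`, and the pruning condition
`F(t) + C(t+1, s) + g(t) + K ≥ F(s) + g(s)` holds for some `1 ≤ t < s`. Then for every
`T > s`, removing the candidate `u = t` from the inner minimization does not change its
value: `F T` is still the least element of the pruned candidate set. -/
theorem piChange_pruned_exact (C : ℕ → ℕ → ℝ) (g : ℕ → ℝ) (F : ℕ → ℝ) (K : ℝ)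
    (hF : ∀ T, 1 ≤ T → IsLeast ({C 1 T} ∪
      {x : ℝ | ∃ u, 1 ≤ u ∧ u < T ∧ x = F u + C (u + 1) T + g u}) (F T))
    (hK : ∀ t s T : ℕ, t < s → s < T →
      C (t + 1) s + C (s + 1) T + K ≤ C (t + 1) T)
    (t s : ℕ) (ht : 1 ≤ t) (hts : t < s)
    (hprune : F t + C (t + 1) s + g t + K ≥ F s + g s) :
    ∀ T, s < T → IsLeast ({C 1 T} ∪
      {x : ℝ | ∃ u, 1 ≤ u ∧ u < T ∧ u ≠ t ∧ x = F u + C (u + 1) T + g u}) (F T) := by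
  intro T hsT
  obtain ⟨hmem, hlb⟩ := hF T (by omega)
  refine ⟨?_, ?_⟩
  · rcases hmem with h | ⟨u, hu1, huT, hu⟩
    · exact Or.inl h
    · right
      by_cases hut : u = t
      · subst hut
        refine ⟨s, by omega, hsT, by omega, le_antisymm ?_ ?_⟩
        · exact hlb (Or.inr ⟨s, by omega, hsT, rfl⟩)
        · linarith [hK u s T hts hsT]
      · exact ⟨u, hu1, huT, hut, hu⟩
  · rintro x (h | ⟨u, hu1, huT, -, hu⟩)
    · exact hlb (Or.inl h)
    · exact hlb (Or.inr ⟨u, hu1, huT, hu⟩)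
end
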